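/- Under the truncated regression model, if E[‖X‖²] < ∞ and the K×K matrix E[X Xᵀ] is nonsingular, then the (K+1)×(K+1) matrix E[ H(Y, X; δ₀, γ₀) · 1_{Y > c} ] is nonsingular (equivalently, the expected Hessian at the true parameters under the distribution of (Y, X) conditional on the truncation event {Y > c} is nonsingular). (This verifies the nonsingularity condition for asymptotic normality of the conditional ML estimator in the truncated regression model.) -/

import Mathlib

open MeasureTheory ProbabilityTheory Real Filter Set

noncomputable section

/-- The standard normal density `φ`. -/
def gPDF (t : ℝ) : ℝ := (Real.sqrt (2 * Real.pi))⁻¹ * Real.exp (-t ^ 2 / 2)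

/-- The standard normal cumulative distribution function `Φ`. -/
def gCDF (t : ℝ) : ℝ := ∫ s in Set.Iic t, gPDF s

/-- The inverse Mills ratio `λ(v) = φ(v)/(1 - Φ(v))`. -/
def mills (v : ℝ) : ℝ := gPDF v / (1 - gCDF v)

/-- Euclidean norm of a vector in `ℝ^n`. -/
def vnorm {n : ℕ} (x : Fin n → ℝ) : ℝ := Real.sqrt (∑ i, (x i) ^ 2)

/-- Frobenius (Euclidean) norm of a real matrix. -/
def frob {m n : Type*} [Fintype m] [Fintype n] (M : Matrix m n ℝ) : ℝ :=
  Real.sqrt (∑ i, ∑ j, (M i j) ^ 2)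

/-- Dot product `xᵀδ`. -/
def dotp {n : ℕ} (x δ : Fin n → ℝ) : ℝ := ∑ i, x i * δ i

/-- The block matrix `[[x xᵀ, -y·x], [-y·xᵀ, γ⁻² + y²]]`. -/
def blockA (K : ℕ) (x : Fin K → ℝ) (y γ : ℝ) :
    Matrix (Fin K ⊕ Unit) (Fin K ⊕ Unit) ℝ :=
  Matrix.fromBlocks (Matrix.vecMulVec x x) (Matrix.of fun i _ => -(y * x i))
    (Matrix.of fun _ j => -(y * x j)) (Matrix.of fun _ _ => γ⁻¹ ^ 2 + y ^ 2)

/-- The block matrix `[[x xᵀ, -c·x], [-c·xᵀ, c²]]`. -/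
def blockB (K : ℕ) (x : Fin K → ℝ) (c : ℝ) :
    Matrix (Fin K ⊕ Unit) (Fin K ⊕ Unit) ℝ :=
  Matrix.fromBlocks (Matrix.vecMulVec x x) (Matrix.of fun i _ => -(c * x i))
    (Matrix.of fun _ j => -(c * x j)) (Matrix.of fun _ _ => c ^ 2)

/-- The Hessian of the reparameterized log conditional likelihood of the truncated
regression model, `H(y, x; δ, γ)` with `v = γc - xᵀδ`. -/
def truncHess (K : ℕ) (c y : ℝ) (x δ : Fin K → ℝ) (γ : ℝ) :
    Matrix (Fin K ⊕ Unit) (Fin K ⊕ Unit) ℝ :=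
  -(blockA K x y γ) +
    (mills (γ * c - dotp x δ) * (mills (γ * c - dotp x δ) - (γ * c - dotp x δ))) • blockB K x c

/-- The Hessian of the reparameterized log conditional likelihood of the Tobit model,
`H(y, x, d; δ, γ)` with `v = γc - xᵀδ`. -/
def tobitHess (K : ℕ) (c y : ℝ) (x : Fin K → ℝ) (d : ℝ) (δ : Fin K → ℝ) (γ : ℝ) :
    Matrix (Fin K ⊕ Unit) (Fin K ⊕ Unit) ℝ :=
  -((1 - d) • blockA K x y γ) -
    (d * mills (-(γ * c - dotp x δ)) * (mills (-(γ * c - dotp x δ)) + (γ * c - dotp x δ))) •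
      blockB K x c

/-- The score of the reparameterized log conditional likelihood of the Tobit model,
`s(y, x, d; δ, γ)` with `v = γc - xᵀδ`. -/
def tobitScore (K : ℕ) (c y : ℝ) (x : Fin K → ℝ) (d : ℝ) (δ : Fin K → ℝ) (γ : ℝ) :
    Fin K ⊕ Unit → ℝ := fun j =>
  (1 - d) *
      Sum.elim (fun i => (γ * y - dotp x δ) * x i) (fun _ => 1 / γ - (γ * y - dotp x δ) * y) j
    + d * mills (-(γ * c - dotp x δ)) * Sum.elim (fun i => -x i) (fun _ => c) j


lemma gPDF_eq_gaussianPDFReal : gPDF = gaussianPDFReal 0 1 := by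
  funext t
  simp [gPDF, gaussianPDFReal]

lemma gPDF_pos (t : ℝ) : 0 < gPDF t := by
  unfold gPDF; positivity

lemma continuous_gPDF : Continuous gPDF := by
  unfold gPDF; fun_prop

lemma hasDerivAt_gPDF (t : ℝ) : HasDerivAt gPDF (-(t * gPDF t)) t := by
  unfold gPDF
  have h : HasDerivAt (fun t : ℝ => -t ^ 2 / 2) (-t) t := by
    have := ((hasDerivAt_pow 2 t).neg).div_const 2
    convert! this using 1
    push_cast
    ring
  convert! (h.exp.const_mul (Real.sqrt (2 * Real.pi))⁻¹) using 1
  ring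

lemma integrable_pow_mul_gPDF (n : ℕ) : Integrable (fun t => t ^ n * gPDF t) := by
  have h := (integrable_rpow_mul_exp_neg_mul_sq (b := 1 / 2) (by norm_num) (s := n)
    (by linarith [n.cast_nonneg (α := ℝ)])).const_mul (Real.sqrt (2 * Real.pi))⁻¹
  refine h.congr (Eventually.of_forall fun t => ?_)
  simp only [gPDF, Real.rpow_natCast]
  rw [show -(1 / 2) * t ^ 2 = -t ^ 2 / 2 by ring]
  ring

/-- The truncated moments `∫_{t > v} tⁿ φ(t) dt`. -/
def gMoment (n : ℕ) (v : ℝ) : ℝ := ∫ t in Ioi v, t ^ n * gPDF t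

lemma gMoment_one (v : ℝ) : gMoment 1 v = gPDF v := by
  have hi := (integrable_pow_mul_gPDF 1).neg.integrableOn (s := Ioi v)
  have hd : ∀ t, HasDerivAt gPDF ((-fun t => t ^ 1 * gPDF t) t) t := fun t => by
    simpa using hasDerivAt_gPDF t
  have h0 : IntegrableOn gPDF (Ioi v) := by
    simpa using (integrable_pow_mul_gPDF 0).integrableOn (s := Ioi v)
  have h := integral_Ioi_of_hasDerivAt_of_tendsto' (fun t _ => hd t) hi
    (tendsto_zero_of_hasDerivAt_of_integrableOn_Ioi (fun t _ => hd t) hi h0)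
  simp only [Pi.neg_apply, integral_neg] at h
  unfold gMoment
  linarith

lemma gMoment_add_two (n : ℕ) (v : ℝ) :
    gMoment (n + 2) v = v ^ (n + 1) * gPDF v + (n + 1) * gMoment n v := by
  have h1 := ((integrable_pow_mul_gPDF n).const_mul (n + 1 : ℝ)).integrableOn (s := Ioi v)
  have h2 := (integrable_pow_mul_gPDF (n + 2)).integrableOn (s := Ioi v)
  have hd : ∀ t, HasDerivAt (fun t => t ^ (n + 1) * gPDF t)
      ((n + 1) * (t ^ n * gPDF t) - t ^ (n + 2) * gPDF t) t := fun t => by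
    convert! (hasDerivAt_pow (n + 1) t).mul (hasDerivAt_gPDF t) using 1
    push_cast
    ring
  have h := integral_Ioi_of_hasDerivAt_of_tendsto' (fun t _ => hd t) (h1.sub h2)
    (tendsto_zero_of_hasDerivAt_of_integrableOn_Ioi (fun t _ => hd t) (h1.sub h2)
      (integrable_pow_mul_gPDF (n + 1)).integrableOn)
  rw [integral_sub h1 h2, integral_const_mul] at h
  unfold gMoment
  linarith

lemma integrable_gPDF : Integrable gPDF := by
  simpa using integrable_pow_mul_gPDF 0

lemma one_sub_gCDF (v : ℝ) : 1 - gCDF v = gMoment 0 v := by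
  have h := intervalIntegral.integral_Iic_add_Ioi (b := v) integrable_gPDF.integrableOn
    integrable_gPDF.integrableOn
  have h1 : ∫ t, gPDF t = 1 := by
    rw [gPDF_eq_gaussianPDFReal]
    exact integral_gaussianPDFReal_eq_one 0 one_ne_zero
  simp only [gMoment, gCDF, pow_zero, one_mul]
  linarith

lemma gMoment_zero_pos (v : ℝ) : 0 < gMoment 0 v := by
  simp only [gMoment, pow_zero, one_mul]
  rw [setIntegral_pos_iff_support_of_nonneg_ae
    (Eventually.of_forall fun t => (gPDF_pos t).le) integrable_gPDF.integrableOn]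
  have : Function.support gPDF = univ := by
    ext t; simp [(gPDF_pos t).ne']
  simp [this]

lemma mills_mul_gMoment (v : ℝ) : mills v * gMoment 0 v = gPDF v := by
  rw [mills, one_sub_gCDF, div_mul_cancel₀ _ (gMoment_zero_pos v).ne']

lemma measurable_mills : Measurable mills := by
  have h : Monotone gCDF := fun a b hab =>
    setIntegral_mono_set integrable_gPDF.integrableOn
      (Eventually.of_forall fun t => (gPDF_pos t).le) (Iic_subset_Iic.2 hab).eventuallyLE
  exact continuous_gPDF.measurable.div (measurable_const.sub h.measurable)

lemma integral_quartic_mul_gPDF (a₀ a₁ a₂ a₃ a₄ v : ℝ) :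
    ∫ t in Ioi v, gPDF t * (a₀ + a₁ * t + a₂ * t ^ 2 + a₃ * t ^ 3 + a₄ * t ^ 4) =
      a₀ * gMoment 0 v + a₁ * gMoment 1 v + a₂ * gMoment 2 v + a₃ * gMoment 3 v
        + a₄ * gMoment 4 v := by
  have hi (n : ℕ) (a : ℝ) : Integrable (fun t => a * (t ^ n * gPDF t)) (volume.restrict (Ioi v)) :=
    ((integrable_pow_mul_gPDF n).const_mul a).integrableOn
  simp only [gMoment, ← integral_const_mul]
  rw [← integral_add' (hi 0 a₀) (hi 1 a₁), ← integral_add' ((hi 0 a₀).add (hi 1 a₁)) (hi 2 a₂),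
    ← integral_add' (((hi 0 a₀).add (hi 1 a₁)).add (hi 2 a₂)) (hi 3 a₃),
    ← integral_add' ((((hi 0 a₀).add (hi 1 a₁)).add (hi 2 a₂)).add (hi 3 a₃)) (hi 4 a₄)]
  congr 1
  funext t
  simp only [Pi.add_apply]
  ring

lemma integrable_quartic_mul_gPDF (a₀ a₁ a₂ a₃ a₄ : ℝ) :
    Integrable fun t => gPDF t * (a₀ + a₁ * t + a₂ * t ^ 2 + a₃ * t ^ 3 + a₄ * t ^ 4) := by
  have hi (n : ℕ) (a : ℝ) : Integrable (fun t => a * (t ^ n * gPDF t)) :=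
    (integrable_pow_mul_gPDF n).const_mul a
  refine (((((hi 0 a₀).add (hi 1 a₁)).add (hi 2 a₂)).add (hi 3 a₃)).add (hi 4 a₄)).congr
    (Eventually.of_forall fun t => ?_)
  simp only [Pi.add_apply]
  ring

/-- The negative of the expected Hessian form is the variance of the score under truncation. -/
lemma integral_hessian_form_eq_integral_sq (p q v : ℝ) :
    ∫ t in Ioi v, gPDF t * ((p - q * t) ^ 2 + q ^ 2 - mills v * (mills v - v) * (p - q * v) ^ 2) =
      ∫ t in Ioi v, gPDF t * (p * t - q * t ^ 2 - (p * mills v - q * (1 + v * mills v))) ^ 2 := by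
  have hl : (fun t => gPDF t *
      ((p - q * t) ^ 2 + q ^ 2 - mills v * (mills v - v) * (p - q * v) ^ 2)) = fun t => gPDF t *
      ((p ^ 2 + q ^ 2 - mills v * (mills v - v) * (p - q * v) ^ 2) + (-2 * p * q) * t
        + q ^ 2 * t ^ 2 + 0 * t ^ 3 + 0 * t ^ 4) := by
    funext t; ring
  have hr : (fun t => gPDF t * (p * t - q * t ^ 2 - (p * mills v - q * (1 + v * mills v))) ^ 2) =
      fun t => gPDF t * ((p * mills v - q * (1 + v * mills v)) ^ 2
        + (-2 * p * (p * mills v - q * (1 + v * mills v))) * t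
        + (p ^ 2 + 2 * q * (p * mills v - q * (1 + v * mills v))) * t ^ 2
        + (-2 * p * q) * t ^ 3 + q ^ 2 * t ^ 4) := by
    funext t; ring
  have h2 := gMoment_add_two 0 v
  have h3 := gMoment_add_two 1 v
  have h4 := gMoment_add_two 2 v
  norm_num at h2 h3 h4
  rw [hl, hr, integral_quartic_mul_gPDF, integral_quartic_mul_gPDF, h4, h3, h2, gMoment_one,
    ← mills_mul_gMoment v]
  ring

lemma integral_hessian_form_nonneg (p q v : ℝ) :
    0 ≤ ∫ t in Ioi v,
      gPDF t * ((p - q * t) ^ 2 + q ^ 2 - mills v * (mills v - v) * (p - q * v) ^ 2) := by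
  rw [integral_hessian_form_eq_integral_sq]
  exact integral_nonneg fun t => mul_nonneg (gPDF_pos t).le (sq_nonneg _)

lemma eq_zero_of_integral_hessian_form_eq_zero {p q v : ℝ}
    (h : ∫ t in Ioi v,
      gPDF t * ((p - q * t) ^ 2 + q ^ 2 - mills v * (mills v - v) * (p - q * v) ^ 2) = 0) :
    p = 0 ∧ q = 0 := by
  rw [integral_hessian_form_eq_integral_sq] at h
  set m := p * mills v - q * (1 + v * mills v)
  have hi : Integrable fun t => gPDF t * (p * t - q * t ^ 2 - m) ^ 2 := by
    convert integrable_quartic_mul_gPDF (m ^ 2) (-2 * p * m) (p ^ 2 + 2 * q * m) (-2 * p * q)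
      (q ^ 2) using 2
    ring
  rw [integral_eq_zero_iff_of_nonneg (fun t => mul_nonneg (gPDF_pos t).le (sq_nonneg _))
    hi.integrableOn] at h
  have hc : Continuous fun t => (p * t - q * t ^ 2 - m) ^ 2 := by fun_prop
  have hz := Measure.eqOn_open_of_ae_eq h isOpen_Ioi (continuous_gPDF.mul hc).continuousOn
    continuousOn_const
  have key (t : ℝ) (ht : v < t) : p * t - q * t ^ 2 - m = 0 := by
    simpa [(gPDF_pos t).ne'] using hz ht
  have e1 := key (v + 1) (by linarith)
  have e2 := key (v + 2) (by linarith)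
  have e3 := key (v + 3) (by linarith)
  have hq : q = 0 := by linarith
  subst hq
  exact ⟨by linarith, rfl⟩

lemma le_mills (v : ℝ) : v ≤ mills v := by
  have h : 0 ≤ ∫ t in Ioi v, gPDF t * (-v + 1 * t + 0 * t ^ 2 + 0 * t ^ 3 + 0 * t ^ 4) :=
    setIntegral_nonneg measurableSet_Ioi fun t ht =>
      mul_nonneg (gPDF_pos t).le (by have : v < t := ht; linarith)
  rw [integral_quartic_mul_gPDF, gMoment_one, ← mills_mul_gMoment] at h
  have hS := gMoment_zero_pos v
  nlinarith

lemma mills_nonneg (v : ℝ) : 0 ≤ mills v := by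
  rw [mills, one_sub_gCDF]
  exact div_nonneg (gPDF_pos v).le (gMoment_zero_pos v).le

lemma mills_mul_sub_nonneg (v : ℝ) : 0 ≤ mills v * (mills v - v) :=
  mul_nonneg (mills_nonneg v) (sub_nonneg.2 (le_mills v))

lemma mills_mul_sub_le_one (v : ℝ) : mills v * (mills v - v) ≤ 1 := by
  have h := integral_hessian_form_nonneg 1 0 v
  have e := integral_quartic_mul_gPDF (1 - mills v * (mills v - v)) 0 0 0 0 v
  norm_num at h e
  rw [e] at h
  have := nonneg_of_mul_nonneg_left h (gMoment_zero_pos v)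
  linarith

lemma integral_gaussianReal_std (f : ℝ → ℝ) :
    ∫ t, f t ∂(gaussianReal 0 1) = ∫ t, gPDF t * f t := by
  rw [integral_gaussianReal_eq_integral_smul one_ne_zero, ← gPDF_eq_gaussianPDFReal]
  simp only [smul_eq_mul]

/-- If the expected Hessian form vanishes under truncation, then its coefficients vanish. -/
lemma ae_eq_zero_of_setIntegral_hessian_form_eq_zero {Ω E : Type*} [MeasurableSpace Ω]
    [MeasurableSpace E] {P : Measure Ω} [IsProbabilityMeasure P] {X : Ω → E} (hX : Measurable X)
    {Z : Ω → ℝ} (hZ : Measurable Z) (hlaw : P.map Z = gaussianReal 0 1) (hindep : IndepFun X Z P)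
    {p v : E → ℝ} (hp : Measurable p) (hv : Measurable v) {q : ℝ}
    (hint : IntegrableOn (fun ω => (p (X ω) - q * Z ω) ^ 2 + q ^ 2
      - mills (v (X ω)) * (mills (v (X ω)) - v (X ω)) * (p (X ω) - q * v (X ω)) ^ 2)
      {ω | v (X ω) < Z ω} P)
    (hzero : ∫ ω in {ω | v (X ω) < Z ω}, ((p (X ω) - q * Z ω) ^ 2 + q ^ 2
      - mills (v (X ω)) * (mills (v (X ω)) - v (X ω)) * (p (X ω) - q * v (X ω)) ^ 2) ∂P = 0) :
    ∀ᵐ ω ∂P, p (X ω) = 0 ∧ q = 0 := by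
  have hmap : P.map (fun ω => (X ω, Z ω)) = (P.map X).prod (gaussianReal 0 1) := by
    rw [(indepFun_iff_map_prod_eq_prod_map_map hX.aemeasurable hZ.aemeasurable).1 hindep, hlaw]
  have hXZ : Measurable fun ω => (X ω, Z ω) := hX.prodMk hZ
  have := Measure.isProbabilityMeasure_map (μ := P) hX.aemeasurable
  let f : E × ℝ → ℝ := fun a => (p a.1 - q * a.2) ^ 2 + q ^ 2
    - mills (v a.1) * (mills (v a.1) - v a.1) * (p a.1 - q * v a.1) ^ 2
  have hf : Measurable f := by
    have hp' : Measurable fun a : E × ℝ => p a.1 := hp.comp measurable_fst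
    have hv' : Measurable fun a : E × ℝ => v a.1 := hv.comp measurable_fst
    have hm' : Measurable fun a : E × ℝ => mills (v a.1) := measurable_mills.comp hv'
    fun_prop
  let S : Set (E × ℝ) := {a | v a.1 < a.2}
  have hS : MeasurableSet S := measurableSet_lt (hv.comp measurable_fst) measurable_snd
  have hg : Measurable (S.indicator f) := hf.indicator hS
  have hS' : MeasurableSet {ω | v (X ω) < Z ω} := measurableSet_lt (hv.comp hX) hZ
  have hcomp : (fun ω => S.indicator f (X ω, Z ω)) =
      {ω | v (X ω) < Z ω}.indicator (fun ω => f (X ω, Z ω)) := rfl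
  have hgi : Integrable (S.indicator f) ((P.map X).prod (gaussianReal 0 1)) := by
    rw [← hmap, integrable_map_measure hg.aestronglyMeasurable hXZ.aemeasurable]
    exact (integrable_indicator_iff hS').2 hint
  have hinner (x : E) : ∫ t, S.indicator f (x, t) ∂(gaussianReal 0 1) =
      ∫ t in Ioi (v x), gPDF t * ((p x - q * t) ^ 2 + q ^ 2
        - mills (v x) * (mills (v x) - v x) * (p x - q * v x) ^ 2) := by
    rw [integral_gaussianReal_std, ← integral_indicator measurableSet_Ioi]
    congr 1
    funext t
    by_cases h : v x < t
    · rw [indicator_of_mem (show (x, t) ∈ S from h), indicator_of_mem (show t ∈ Ioi (v x) from h)]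
    · rw [indicator_of_notMem (show (x, t) ∉ S from h),
        indicator_of_notMem (show t ∉ Ioi (v x) from h), mul_zero]
  have h0 : ∫ x, ∫ t, S.indicator f (x, t) ∂(gaussianReal 0 1) ∂(P.map X) = 0 := by
    rw [← integral_prod _ hgi, ← hmap,
      integral_map hXZ.aemeasurable hg.aestronglyMeasurable, hcomp, integral_indicator hS']
    exact hzero
  rw [integral_eq_zero_iff_of_nonneg
    (fun x => (hinner x).symm ▸ integral_hessian_form_nonneg _ _ _) hgi.integral_prod_left] at h0
  filter_upwards [ae_of_ae_map hX.aemeasurable h0] with ω hω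
  exact eq_zero_of_integral_hessian_form_eq_zero ((hinner (X ω)).symm.trans hω)

open Matrix in
lemma dotProduct_fromBlocks_mulVec {K : ℕ} (x : Fin K → ℝ) (s d : ℝ) (u : Fin K ⊕ Unit → ℝ) :
    u ⬝ᵥ (fromBlocks (vecMulVec x x) (of fun i _ => -(s * x i)) (of fun _ j => -(s * x j))
      (of fun _ _ => d)) *ᵥ u =
    dotp x (u ∘ Sum.inl) ^ 2 - 2 * (s * u (Sum.inr ())) * dotp x (u ∘ Sum.inl)
      + d * u (Sum.inr ()) ^ 2 := by
  set M : Matrix (Fin K ⊕ Unit) (Fin K ⊕ Unit) ℝ := fromBlocks (vecMulVec x x)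
    (of fun i _ => -(s * x i)) (of fun _ j => -(s * x j)) (of fun _ _ => d) with hM
  have hl (i : Fin K) : (M *ᵥ u) (Sum.inl i) =
      x i * (dotp x (u ∘ Sum.inl) - s * u (Sum.inr ())) := by
    simp only [hM, mulVec, dotProduct, Fintype.sum_sum_type, fromBlocks_apply₁₁, fromBlocks_apply₁₂,
      vecMulVec_apply, of_apply, dotp, Finset.univ_unique, Finset.sum_singleton, mul_sub,
      Finset.mul_sum, Function.comp_apply, PUnit.default_eq_unit]
    simp only [mul_assoc, neg_mul, ← sub_eq_add_neg]
    ring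
  have hr : (M *ᵥ u) (Sum.inr ()) =
      d * u (Sum.inr ()) - s * dotp x (u ∘ Sum.inl) := by
    simp only [hM, mulVec, dotProduct, Fintype.sum_sum_type, fromBlocks_apply₂₁, fromBlocks_apply₂₂,
      of_apply, dotp, Finset.univ_unique, Finset.sum_singleton, Finset.mul_sum,
      Function.comp_apply, PUnit.default_eq_unit, neg_mul, Finset.sum_neg_distrib, mul_assoc]
    ring
  have hs (r : ℝ) : ∑ i, u (Sum.inl i) * (x i * r) = dotp x (u ∘ Sum.inl) * r := by
    rw [dotp, Finset.sum_mul]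
    exact Finset.sum_congr rfl fun i _ => by simp only [Function.comp_apply]; ring
  rw [dotProduct, Fintype.sum_sum_type]
  simp only [hl, Finset.univ_unique, Finset.sum_singleton, PUnit.default_eq_unit, hr, hs]
  ring

open Matrix in
lemma dotProduct_truncHess_mulVec {K : ℕ} (c y : ℝ) (x δ : Fin K → ℝ) {γ : ℝ} (hγ : γ ≠ 0)
    (u : Fin K ⊕ Unit → ℝ) :
    u ⬝ᵥ truncHess K c y x δ γ *ᵥ u =
      -((dotp x (u ∘ Sum.inl) - γ⁻¹ * u (Sum.inr ()) * dotp x δ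
          - γ⁻¹ * u (Sum.inr ()) * (γ * y - dotp x δ)) ^ 2 + (γ⁻¹ * u (Sum.inr ())) ^ 2
        - mills (γ * c - dotp x δ) * (mills (γ * c - dotp x δ) - (γ * c - dotp x δ))
          * (dotp x (u ∘ Sum.inl) - γ⁻¹ * u (Sum.inr ()) * dotp x δ
            - γ⁻¹ * u (Sum.inr ()) * (γ * c - dotp x δ)) ^ 2) := by
  rw [truncHess, add_mulVec, neg_mulVec, smul_mulVec, dotProduct_add, dotProduct_neg,
    dotProduct_smul, blockA, blockB, dotProduct_fromBlocks_mulVec, dotProduct_fromBlocks_mulVec,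
    smul_eq_mul]
  have h (s : ℝ) : γ⁻¹ * u (Sum.inr ()) * dotp x δ + γ⁻¹ * u (Sum.inr ()) * (γ * s - dotp x δ) =
      s * u (Sum.inr ()) := by
    field_simp
    ring
  rw [sub_sub, sub_sub, h, h]
  ring

open Matrix in
lemma integrable_dotProduct_mulVec {Ω ι : Type*} [Fintype ι] [MeasurableSpace Ω] {μ : Measure Ω}
    {A : Ω → Matrix ι ι ℝ} (hA : ∀ i j, Integrable (fun ω => A ω i j) μ) (u : ι → ℝ) :
    Integrable (fun ω => u ⬝ᵥ A ω *ᵥ u) μ := by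
  simp only [dotProduct, mulVec]
  exact integrable_finsetSum _ fun i _ =>
    (integrable_finsetSum _ fun j _ => (hA i j).mul_const _).const_mul _

open Matrix in
lemma dotProduct_integral_mulVec {Ω ι : Type*} [Fintype ι] [MeasurableSpace Ω] {μ : Measure Ω}
    {A : Ω → Matrix ι ι ℝ} (hA : ∀ i j, Integrable (fun ω => A ω i j) μ) (u : ι → ℝ) :
    u ⬝ᵥ (of fun i j => ∫ ω, A ω i j ∂μ) *ᵥ u = ∫ ω, u ⬝ᵥ A ω *ᵥ u ∂μ := by
  simp only [dotProduct, mulVec, of_apply]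
  rw [integral_finsetSum _ fun i _ =>
    (integrable_finsetSum _ fun j _ => (hA i j).mul_const _).const_mul _]
  refine Finset.sum_congr rfl fun i _ => ?_
  rw [integral_const_mul, integral_finsetSum _ fun j _ => (hA i j).mul_const _]
  simp only [integral_mul_const]

lemma measurable_dotp {K : ℕ} (δ : Fin K → ℝ) : Measurable fun x => dotp x δ := by
  unfold dotp; fun_prop

lemma integrable_truncHess {Ω : Type*} [MeasurableSpace Ω] {P : Measure Ω} [IsFiniteMeasure P]
    {K : ℕ} {X : Ω → Fin K → ℝ} (hX : Measurable X) (hX2 : ∀ i, MemLp (fun ω => X ω i) 2 P)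
    {Y : Ω → ℝ} (hY2 : MemLp Y 2 P) (c γ : ℝ) (δ : Fin K → ℝ) (i j : Fin K ⊕ Unit) :
    Integrable (fun ω => truncHess K c (Y ω) (X ω) δ γ i j) P := by
  have hXX (i j : Fin K) : Integrable (fun ω => X ω i * X ω j) P :=
    (hX2 i).integrable_mul (hX2 j)
  have hYX (i : Fin K) : Integrable (fun ω => Y ω * X ω i) P := hY2.integrable_mul (hX2 i)
  have hX1 (i : Fin K) : Integrable (fun ω => X ω i) P := (hX2 i).integrable (by norm_num)
  have hA : Integrable (fun ω => blockA K (X ω) (Y ω) γ i j) P := by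
    rcases i with i | i <;> rcases j with j | j
    · exact hXX i j
    · exact (hYX i).neg
    · exact (hYX j).neg
    · exact (integrable_const _).add hY2.integrable_sq
  have hB : Integrable (fun ω => blockB K (X ω) c i j) P := by
    rcases i with i | i <;> rcases j with j | j
    · exact hXX i j
    · exact ((hX1 i).const_mul c).neg
    · exact ((hX1 j).const_mul c).neg
    · exact integrable_const _
  have hv : Measurable fun ω => γ * c - dotp (X ω) δ :=
    measurable_const.sub ((measurable_dotp δ).comp hX)
  have hm := measurable_mills.comp hv
  refine hA.neg.add (hB.bdd_mul (c := 1) (hm.mul (hm.sub hv)).aestronglyMeasurable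
    (Eventually.of_forall fun ω => ?_))
  change ‖mills _ * (mills _ - _)‖ ≤ 1
  rw [Real.norm_of_nonneg (mills_mul_sub_nonneg _)]
  exact mills_mul_sub_le_one _

lemma memLp_two_of_integrable_vnorm_sq {Ω : Type*} [MeasurableSpace Ω] {P : Measure Ω} {K : ℕ}
    {X : Ω → Fin K → ℝ} (hX : Measurable X) (hint : Integrable (fun ω => vnorm (X ω) ^ 2) P)
    (i : Fin K) : MemLp (fun ω => X ω i) 2 P := by
  have hi : Measurable fun ω => X ω i := (measurable_pi_apply i).comp hX
  rw [memLp_two_iff_integrable_sq hi.aestronglyMeasurable]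
  refine hint.mono' (hi.pow_const 2).aestronglyMeasurable (Eventually.of_forall fun ω => ?_)
  rw [Real.norm_of_nonneg (sq_nonneg _), vnorm, Real.sq_sqrt (by positivity)]
  exact Finset.single_le_sum (f := fun i => X ω i ^ 2) (fun j _ => sq_nonneg _) (Finset.mem_univ i)

/-- Nonsingularity of the expected truncated-regression Hessian at the true parameters,
on the truncation event `{Y > c}`, under nonsingularity of `E[X Xᵀ]`. -/
theorem truncated_expected_hessian_nonsingular (K : ℕ) (hK : 0 < K) {Ω : Type*} [MeasurableSpace Ω]
    (P : Measure Ω) [IsProbabilityMeasure P]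
    (X : Ω → Fin K → ℝ) (hX : Measurable X) (ε : Ω → ℝ) (hε : Measurable ε)
    (σ₀ : ℝ) (hσ : 0 < σ₀)
    (hgauss : Measure.map ε P = gaussianReal 0 ⟨σ₀ ^ 2, sq_nonneg σ₀⟩)
    (hindep : IndepFun X ε P)
    (β₀ : Fin K → ℝ) (c : ℝ)
    (Y : Ω → ℝ) (hY : ∀ ω, Y ω = dotp (X ω) β₀ + ε ω)
    (δ₀ : Fin K → ℝ) (hδ₀ : δ₀ = fun i => β₀ i / σ₀) (γ₀ : ℝ) (hγ₀ : γ₀ = 1 / σ₀)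
    (hint : Integrable (fun ω => vnorm (X ω) ^ 2) P)
    (hns : (Matrix.of fun i j => ∫ ω, X ω i * X ω j ∂P).det ≠ 0) :
    (Matrix.of fun i j =>
        ∫ ω in {ω | c < Y ω}, truncHess K c (Y ω) (X ω) δ₀ γ₀ i j ∂P).det ≠ 0 := by
  have hγ : γ₀ ≠ 0 := by rw [hγ₀]; positivity
  have hX2 := memLp_two_of_integrable_vnorm_sq hX hint
  have hε2 : MemLp ε 2 P := by
    have h := memLp_id_gaussianReal' (μ := 0) (v := ⟨σ₀ ^ 2, sq_nonneg σ₀⟩) 2 (by norm_num)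
    rw [← hgauss] at h
    exact h.comp_of_map hε.aemeasurable
  have hY2 : MemLp Y 2 P := by
    rw [show Y = fun ω => (∑ i, X ω i * β₀ i) + ε ω from funext hY]
    exact (memLp_finsetSum _ fun i _ => (hX2 i).mul_const (β₀ i)).add hε2
  have hZ (ω : Ω) : γ₀ * Y ω - dotp (X ω) δ₀ = ε ω / σ₀ := by
    have hd : dotp (X ω) δ₀ = dotp (X ω) β₀ / σ₀ := by
      simp only [dotp, hδ₀, Finset.sum_div, mul_div_assoc]
    rw [hd, hγ₀, hY]
    ring
  have hset : {ω | c < Y ω} = {ω | γ₀ * c - dotp (X ω) δ₀ < ε ω / σ₀} := by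
    have hpos : 0 < γ₀ := by rw [hγ₀]; positivity
    ext ω
    simp only [mem_ofPred_eq, ← hZ, sub_lt_sub_iff_right, mul_lt_mul_iff_right₀ hpos]
  have hlaw : P.map (fun ω => ε ω / σ₀) = gaussianReal 0 1 := by
    have h := (gaussianReal_div_const (X := ε) ⟨hε.aemeasurable, hgauss⟩ σ₀).map_eq
    rw [h, zero_div]
    congr 1
    exact div_self fun h => (pow_pos hσ 2).ne' (congrArg NNReal.toReal h)
  have hH (i j) : Integrable (fun ω => truncHess K c (Y ω) (X ω) δ₀ γ₀ i j)
      (P.restrict {ω | c < Y ω}) := (integrable_truncHess hX hX2 hY2 c γ₀ δ₀ i j).restrict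
  intro hdet
  obtain ⟨u, hu, hMu⟩ := Matrix.exists_mulVec_eq_zero_iff.2 hdet
  have hquad := dotProduct_integral_mulVec hH u
  have hquadi := integrable_dotProduct_mulVec hH u
  rw [hMu, dotProduct_zero] at hquad
  simp only [dotProduct_truncHess_mulVec c _ _ δ₀ hγ u, hZ] at hquad hquadi
  rw [integral_neg, zero_eq_neg] at hquad
  rw [hset] at hquad hquadi
  have hae := ae_eq_zero_of_setIntegral_hessian_form_eq_zero hX (hε.div_const σ₀) hlaw
    (hindep.comp measurable_id (measurable_id.div_const σ₀))
    (p := fun x => dotp x (u ∘ Sum.inl) - γ₀⁻¹ * u (Sum.inr ()) * dotp x δ₀)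
    (v := fun x => γ₀ * c - dotp x δ₀)
    ((measurable_dotp _).sub ((measurable_dotp _).const_mul _))
    (measurable_const.sub (measurable_dotp _)) (integrable_neg_iff.1 hquadi) hquad
  obtain ⟨_, -, hω⟩ := hae.exists
  have hb : u (Sum.inr ()) = 0 := (mul_eq_zero.1 hω).resolve_left (inv_ne_zero hγ)
  have ha : ∀ᵐ ω ∂P, dotp (X ω) (u ∘ Sum.inl) = 0 := by
    filter_upwards [hae] with ω h
    simpa [hb] using h.1
  refine hns (Matrix.exists_mulVec_eq_zero_iff.1 ⟨u ∘ Sum.inl, fun h => hu ?_, ?_⟩)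
  · ext (i | i)
    · exact congrFun h i
    · exact hb
  · ext i
    simp only [Matrix.mulVec, dotProduct, Matrix.of_apply, Pi.zero_apply, ← integral_mul_const]
    have hij (j : Fin K) : Integrable (fun ω => X ω i * X ω j * (u ∘ Sum.inl) j) P :=
      ((hX2 i).integrable_mul (hX2 j)).mul_const _
    rw [← integral_finsetSum _ fun j _ => hij j]
    refine integral_eq_zero_of_ae ?_
    filter_upwards [ha] with ω h
    simp only [mul_assoc, ← Finset.mul_sum, Pi.zero_apply]
    exact mul_eq_zero_of_right _ h
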